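/- arXiv:1402.3263 — 6 statements merged into one kernel-verified Lean document; each statement's English description precedes it below -/
import Mathlib

section
/- Let n, m be positive integers, let A be a real n×n matrix, B a real n×m matrix, Q a symmetric positive definite real n×n matrix, and U a symmetric positive definite real m×m matrix. If the only vector y ∈ ℝⁿ with Aᵀy = 0 and Bᵀy = 0 is y = 0, then the 2n×2n block matrix M = [[A, B U⁻¹ Bᵀ], [Q, −Aᵀ]] is invertible. -/
open Matrix

theorem stmt_0 (n m : ℕ) (hn : 0 < n) (hm : 0 < m)
    (A : Matrix (Fin n) (Fin n) ℝ) (B : Matrix (Fin n) (Fin m) ℝ)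
    (Q : Matrix (Fin n) (Fin n) ℝ) (U : Matrix (Fin m) (Fin m) ℝ)
    (hQ : Q.PosDef) (hU : U.PosDef)
    (h : ∀ y : Fin n → ℝ, Aᵀ.mulVec y = 0 → Bᵀ.mulVec y = 0 → y = 0) :
    IsUnit (fromBlocks A (B * U⁻¹ * Bᵀ) Q (-Aᵀ)) := by
  rw [← mulVec_injective_iff_isUnit]
  refine (injective_iff_map_eq_zero (mulVecLin (fromBlocks A (B * U⁻¹ * Bᵀ) Q (-Aᵀ)))).2 ?_
  intro v hv
  obtain ⟨x, y, rfl⟩ : ∃ x y, v = Sum.elim x y :=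
    ⟨v ∘ Sum.inl, v ∘ Sum.inr, (Sum.elim_comp_inl_inr v).symm⟩
  rw [mulVecLin_apply, fromBlocks_mulVec, Sum.elim_comp_inl, Sum.elim_comp_inr] at hv
  have h_top : A *ᵥ x + (B * U⁻¹ * Bᵀ) *ᵥ y = 0 := funext fun i => congrFun hv (Sum.inl i)
  have h_bot : Q *ᵥ x + (-Aᵀ) *ᵥ y = 0 := funext fun i => congrFun hv (Sum.inr i)
  rw [neg_mulVec, ← sub_eq_add_neg, sub_eq_zero] at h_bot
  have h_adj : x ⬝ᵥ (Aᵀ *ᵥ y) = y ⬝ᵥ (A *ᵥ x) := by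
    rw [mulVec_transpose, dotProduct_comm, dotProduct_mulVec]
  have h_quad : y ⬝ᵥ ((B * U⁻¹ * Bᵀ) *ᵥ y) = (Bᵀ *ᵥ y) ⬝ᵥ (U⁻¹ *ᵥ (Bᵀ *ᵥ y)) := by
    rw [← mulVec_mulVec, ← mulVec_mulVec, dotProduct_mulVec, mulVec_transpose]
  have h_sum : x ⬝ᵥ (Q *ᵥ x) + (Bᵀ *ᵥ y) ⬝ᵥ (U⁻¹ *ᵥ (Bᵀ *ᵥ y)) = 0 := by
    rw [h_bot, h_adj, ← h_quad, ← dotProduct_add, h_top, dotProduct_zero]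
  have hQ_nonneg := hQ.posSemidef.dotProduct_mulVec_nonneg x
  have hU_nonneg := hU.inv.posSemidef.dotProduct_mulVec_nonneg (Bᵀ *ᵥ y)
  rw [star_trivial] at hQ_nonneg hU_nonneg
  have hx : x = 0 := by
    by_contra hx
    have := hQ.dotProduct_mulVec_pos hx
    rw [star_trivial] at this
    linarith
  have hBy : Bᵀ *ᵥ y = 0 := by
    by_contra hy
    have := hU.inv.dotProduct_mulVec_pos hy
    rw [star_trivial] at this
    linarith
  have hy : y = 0 := h y (by rw [← h_bot, hx, mulVec_zero]) hBy
  rw [hx, hy, Sum.elim_zero_zero]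
end

section
/- Let n, m be positive integers, let A be a real n×n matrix, B a real n×m matrix, Q a symmetric positive definite real n×n matrix, and U a symmetric positive definite real m×m matrix. Then the rank of the 2n×2n block matrix M = [[A, B U⁻¹ Bᵀ], [Q, −Aᵀ]] equals n plus the rank of the n×n matrix A Q⁻¹ Aᵀ + B U⁻¹ Bᵀ. -/
open Matrix

/-- A product of submodules is linearly equivalent to the product of the underlying modules. -/
def Submodule.prodLinearEquiv {R M N : Type*} [Semiring R] [AddCommMonoid M] [AddCommMonoid N]
    [Module R M] [Module R N] (p : Submodule R M) (q : Submodule R N) :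
    p.prod q ≃ₗ[R] p × q :=
  { Equiv.Set.prod (p : Set M) (q : Set N) with
    map_add' := fun _ _ => rfl
    map_smul' := fun _ _ => rfl }

theorem Matrix.rank_fromBlocks_zero_zero {K k l m n : Type*} [Field K] [Fintype k] [Fintype l]
    [Fintype m] [Fintype n] (A : Matrix k m K) (D : Matrix l n K) :
    (fromBlocks A 0 0 D).rank = A.rank + D.rank := by
  let e := LinearEquiv.sumArrowLequivProdArrow k l K K
  let f := LinearEquiv.sumArrowLequivProdArrow m n K K
  have h : e.toLinearMap ∘ₗ (fromBlocks A 0 0 D).mulVecLin =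
      (A.mulVecLin.prodMap D.mulVecLin) ∘ₗ f.toLinearMap := by
    refine LinearMap.ext fun x => ?_
    ext i <;> simp [e, f, fromBlocks_mulVec] <;> rfl
  have hr : (LinearMap.range (fromBlocks A 0 0 D).mulVecLin).map e.toLinearMap =
      (LinearMap.range A.mulVecLin).prod (LinearMap.range D.mulVecLin) := by
    rw [← LinearMap.range_comp, h, LinearMap.range_comp_of_range_eq_top _ f.range,
      LinearMap.range_prodMap]
  rw [rank, ← LinearEquiv.finrank_map_eq e, hr,
    (Submodule.prodLinearEquiv _ _).finrank_eq, Module.finrank_prod, rank, rank]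

/-- The Guttman rank additivity formula, for an invertible bottom-left block. -/
theorem Matrix.rank_fromBlocks_of_isUnit_det₂₁ {K l m n : Type*} [Field K] [Fintype l]
    [Fintype m] [Fintype n] [DecidableEq l] [DecidableEq m] [DecidableEq n]
    (A : Matrix l n K) (B : Matrix l m K) (C : Matrix n n K) (D : Matrix n m K)
    (hC : IsUnit C.det) :
    (fromBlocks A B C D).rank = Fintype.card n + (B - A * C⁻¹ * D).rank := by
  have h : fromBlocks A B C D = (fromBlocks 1 (A * C⁻¹) 0 1 : Matrix (l ⊕ n) (l ⊕ n) K) *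
      fromBlocks 0 (B - A * C⁻¹ * D) C 0 *
        (fromBlocks 1 (C⁻¹ * D) 0 1 : Matrix (n ⊕ m) (n ⊕ m) K) := by
    simp [fromBlocks_multiply, Matrix.mul_assoc, nonsing_inv_mul _ hC,
      mul_nonsing_inv_cancel_left _ _ hC]
  have hs : fromBlocks 0 (B - A * C⁻¹ * D) C 0 =
      (fromBlocks (B - A * C⁻¹ * D) 0 0 C).submatrix (Equiv.refl _) (Equiv.sumComm n m) := by
    ext (i | i) (j | j) <;> rfl
  rw [h, rank_mul_eq_left_of_isUnit_det _ _ (by simp),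
    rank_mul_eq_right_of_isUnit_det _ _ (by simp),
    hs, rank_submatrix, rank_fromBlocks_zero_zero, add_comm,
    rank_of_isUnit C ((isUnit_iff_isUnit_det C).2 hC)]

theorem stmt_2 (n m : ℕ) (hn : 0 < n) (hm : 0 < m)
    (A : Matrix (Fin n) (Fin n) ℝ) (B : Matrix (Fin n) (Fin m) ℝ)
    (Q : Matrix (Fin n) (Fin n) ℝ) (U : Matrix (Fin m) (Fin m) ℝ)
    (hQ : Q.PosDef) (hU : U.PosDef) :
    (fromBlocks A (B * U⁻¹ * Bᵀ) Q (-Aᵀ)).rank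
      = n + (A * Q⁻¹ * Aᵀ + B * U⁻¹ * Bᵀ).rank := by
  rw [rank_fromBlocks_of_isUnit_det₂₁ _ _ _ _ hQ.det_pos.ne'.isUnit, Fintype.card_fin,
    Matrix.mul_neg, sub_neg_eq_add, add_comm (B * U⁻¹ * Bᵀ)]
end

section
/- Let n, m be positive integers, let A be a real n×n matrix, B a real n×m matrix, Q a symmetric real n×n matrix, and U an invertible symmetric real m×m matrix. Suppose E₋ and E₊ are symmetric real n×n matrices, each solving the algebraic Riccati equation X A + Aᵀ X + X B U⁻¹ Bᵀ X − Q = 0, and suppose E₊ − E₋ is invertible. Then the 2n×2n block matrix P = [[Iₙ, Iₙ], [E₋, E₊]] is invertible, and M P = P · D, where M = [[A, B U⁻¹ Bᵀ], [Q, −Aᵀ]] and D is the block-diagonal matrix diag(A + B U⁻¹ Bᵀ E₋, A + B U⁻¹ Bᵀ E₊); equivalently P⁻¹ M P = D. -/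
open Matrix

/-- Graph form of the Riccati equation: `(1, X)` spans an invariant subspace of the Hamiltonian. -/
theorem riccati_lower_row {ι R : Type*} [Fintype ι] [CommRing R] {A S Q X : Matrix ι ι R}
    (h : X * A + Aᵀ * X + X * S * X - Q = 0) :
    Q + -Aᵀ * X = X * (A + S * X) := by
  rw [← sub_eq_zero.mp h]
  noncomm_ring

theorem isUnit_fromBlocks_one_one {ι R : Type*} [Fintype ι] [DecidableEq ι] [CommRing R]
    {X Y : Matrix ι ι R} (h : IsUnit (Y - X)) :
    IsUnit (fromBlocks (1 : Matrix ι ι R) 1 X Y) := by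
  rw [isUnit_iff_isUnit_det] at h ⊢
  rwa [det_fromBlocks_one₁₁, mul_one]

theorem stmt_5 (n m : ℕ) (hn : 0 < n) (hm : 0 < m)
    (A : Matrix (Fin n) (Fin n) ℝ) (B : Matrix (Fin n) (Fin m) ℝ)
    (Q : Matrix (Fin n) (Fin n) ℝ) (U : Matrix (Fin m) (Fin m) ℝ)
    (hQ : Q.IsSymm) (hU : U.IsSymm) (hUunit : IsUnit U)
    (Em Ep : Matrix (Fin n) (Fin n) ℝ) (hEm : Em.IsSymm) (hEp : Ep.IsSymm)
    (hRm : Em * A + Aᵀ * Em + Em * (B * U⁻¹ * Bᵀ) * Em - Q = 0)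
    (hRp : Ep * A + Aᵀ * Ep + Ep * (B * U⁻¹ * Bᵀ) * Ep - Q = 0)
    (hdiff : IsUnit (Ep - Em)) :
    IsUnit (fromBlocks (1 : Matrix (Fin n) (Fin n) ℝ) 1 Em Ep) ∧
    fromBlocks A (B * U⁻¹ * Bᵀ) Q (-Aᵀ) * fromBlocks 1 1 Em Ep =
      fromBlocks 1 1 Em Ep *
        fromBlocks (A + B * U⁻¹ * Bᵀ * Em) 0 0 (A + B * U⁻¹ * Bᵀ * Ep) ∧
    (fromBlocks (1 : Matrix (Fin n) (Fin n) ℝ) 1 Em Ep)⁻¹ *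
        fromBlocks A (B * U⁻¹ * Bᵀ) Q (-Aᵀ) * fromBlocks 1 1 Em Ep =
      fromBlocks (A + B * U⁻¹ * Bᵀ * Em) 0 0 (A + B * U⁻¹ * Bᵀ * Ep) := by
  have hP := isUnit_fromBlocks_one_one hdiff
  have hMP : fromBlocks A (B * U⁻¹ * Bᵀ) Q (-Aᵀ) * fromBlocks 1 1 Em Ep =
      fromBlocks 1 1 Em Ep *
        fromBlocks (A + B * U⁻¹ * Bᵀ * Em) 0 0 (A + B * U⁻¹ * Bᵀ * Ep) := by
    simp only [fromBlocks_multiply, mul_one, one_mul, mul_zero, add_zero, zero_add,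
      riccati_lower_row hRm, riccati_lower_row hRp]
  refine ⟨hP, hMP, ?_⟩
  rw [Matrix.mul_assoc, hMP,
    nonsing_inv_mul_cancel_left _ _ ((isUnit_iff_isUnit_det _).mp hP)]
end

section
/- Let n, m be positive integers, let A be a real n×n matrix, B a real n×m matrix, Q a symmetric real n×n matrix, and U an invertible symmetric real m×m matrix. Suppose E₋ and E₊ are symmetric real n×n matrices, each solving the algebraic Riccati equation X A + Aᵀ X + X B U⁻¹ Bᵀ X − Q = 0, and suppose E₊ − E₋ is invertible. Then for every complex number μ, μ is an eigenvalue of A + B U⁻¹ Bᵀ E₊ if and only if −μ is an eigenvalue of A + B U⁻¹ Bᵀ E₋ (eigenvalues meaning roots of the characteristic polynomial over ℂ). -/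
open Matrix

/-- If an invertible `D` intertwines `M` with `-Nᵀ`, then the roots of the characteristic
polynomial of `M` are the negatives of those of `N`. -/
theorem Matrix.charpoly_isRoot_iff_isRoot_neg {ι R : Type*} [Fintype ι] [DecidableEq ι]
    [CommRing R] {M N D : Matrix ι ι R} (hD : IsUnit D) (h : D * M + Nᵀ * D = 0) (μ : R) :
    M.charpoly.IsRoot μ ↔ N.charpoly.IsRoot (-μ) := by
  have hmul : D * (scalar ι μ - M) = -(scalar ι (-μ) - N)ᵀ * D := by
    have hcomm : D * scalar ι μ = scalar ι μ * D :=
      ((scalar_commute μ (fun r => Commute.all μ r) D).eq).symm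
    have hT : (scalar ι (-μ) - N)ᵀ = -scalar ι μ - Nᵀ := by
      rw [transpose_sub, map_neg, transpose_neg, scalar_apply, diagonal_transpose]
    rw [hT, mul_sub, hcomm, eq_neg_of_add_eq_zero_left h]
    noncomm_ring
  have hdet := congrArg det hmul
  rw [det_mul, det_mul, det_neg, det_transpose, mul_comm, ((isUnit_iff_isUnit_det D).1 hD).mul_left_inj]
    at hdet
  rw [Polynomial.IsRoot.def, Polynomial.IsRoot.def, eval_charpoly, eval_charpoly, hdet]
  exact (isUnit_one.neg.pow _).mul_right_eq_zero

/-- The difference of two symmetric solutions of a Riccati equation intertwines the two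
closed-loop matrices, up to transposition and sign. -/
theorem Matrix.riccati_sub_intertwines {ι R : Type*} [Fintype ι] [CommRing R]
    {A S Q X Y : Matrix ι ι R} (hS : S.IsSymm) (hX : X.IsSymm)
    (hRX : X * A + Aᵀ * X + X * S * X - Q = 0) (hRY : Y * A + Aᵀ * Y + Y * S * Y - Q = 0) :
    (Y - X) * (A + S * Y) + (A + S * X)ᵀ * (Y - X) = 0 := by
  rw [transpose_add, transpose_mul, hS.eq, hX.eq]
  calc _ = (Y * A + Aᵀ * Y + Y * S * Y - Q) - (X * A + Aᵀ * X + X * S * X - Q) := by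
        noncomm_ring
    _ = 0 := by rw [hRX, hRY, sub_zero]

theorem stmt_7 (n m : ℕ) (hn : 0 < n) (hm : 0 < m)
    (A : Matrix (Fin n) (Fin n) ℝ) (B : Matrix (Fin n) (Fin m) ℝ)
    (Q : Matrix (Fin n) (Fin n) ℝ) (U : Matrix (Fin m) (Fin m) ℝ)
    (hQ : Q.IsSymm) (hU : U.IsSymm) (hUunit : IsUnit U)
    (Em Ep : Matrix (Fin n) (Fin n) ℝ) (hEm : Em.IsSymm) (hEp : Ep.IsSymm)
    (hRm : Em * A + Aᵀ * Em + Em * (B * U⁻¹ * Bᵀ) * Em - Q = 0)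
    (hRp : Ep * A + Aᵀ * Ep + Ep * (B * U⁻¹ * Bᵀ) * Ep - Q = 0)
    (hdiff : IsUnit (Ep - Em)) (μ : ℂ) :
    ((A + B * U⁻¹ * Bᵀ * Ep).map fun r => (r : ℂ)).charpoly.IsRoot μ ↔
      ((A + B * U⁻¹ * Bᵀ * Em).map fun r => (r : ℂ)).charpoly.IsRoot (-μ) := by
  have hS : (B * U⁻¹ * Bᵀ).IsSymm := by
    rw [IsSymm, transpose_mul, transpose_mul, transpose_transpose, transpose_nonsing_inv, hU.eq,
      Matrix.mul_assoc]
  have h := congrArg Complex.ofRealHom.mapMatrix (riccati_sub_intertwines hS hEm hRm hRp)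
  rw [map_add, map_mul, map_mul, map_zero] at h
  exact charpoly_isRoot_iff_isRoot_neg (hdiff.map Complex.ofRealHom.mapMatrix) h μ
end

section
/- Let n, m be positive integers, let A be a real n×n matrix, B a real n×m matrix, Q a symmetric real n×n matrix, and U an invertible symmetric real m×m matrix. Suppose E₋ and E₊ are symmetric real n×n matrices, each solving the algebraic Riccati equation X A + Aᵀ X + X B U⁻¹ Bᵀ X − Q = 0, with E₊ − E₋ invertible, and suppose that every complex eigenvalue of A + B U⁻¹ Bᵀ E₋ has negative real part. Then the characteristic polynomial of the 2n×2n block matrix M = [[A, B U⁻¹ Bᵀ], [Q, −Aᵀ]] is the product of the characteristic polynomials of A + B U⁻¹ Bᵀ E₋ and A + B U⁻¹ Bᵀ E₊, and every complex eigenvalue of M has nonzero real part. -/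
open Matrix

section

variable {ι R : Type*} [Fintype ι] [DecidableEq ι] [CommRing R]

/-- Intertwined matrices have the same characteristic polynomial. -/
lemma charpoly_eq_of_isUnit_of_mul_eq_mul {D M N : Matrix ι ι R} (hD : IsUnit D)
    (h : D * M = N * D) : M.charpoly = N.charpoly := by
  obtain ⟨u, rfl⟩ := hD
  rw [← Matrix.charpoly_units_conj u M, ← coe_units_inv, h, mul_assoc, Units.mul_inv,
    mul_one]

/-- A symmetric solution of the Riccati equation block-triangularizes the Hamiltonian matrix. -/
lemma charpoly_hamiltonian_of_riccati {A S Q X : Matrix ι ι R} (hS : S.IsSymm) (hX : X.IsSymm)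
    (h : X * A + Aᵀ * X + X * S * X - Q = 0) :
    (fromBlocks A S Q (-Aᵀ)).charpoly
      = (A + S * X).charpoly * (-(A + S * X)ᵀ).charpoly := by
  have hT : IsUnit (fromBlocks (1 : Matrix ι ι R) 0 X (1 : Matrix ι ι R)) := by
    simp [Matrix.isUnit_iff_isUnit_det]
  rw [← Matrix.charpoly_fromBlocks_zero₂₁ (A + S * X) S]
  refine (charpoly_eq_of_isUnit_of_mul_eq_mul hT ?_).symm
  rw [← sub_eq_zero.mp h]
  simp only [fromBlocks_multiply, transpose_add, transpose_mul, hS.eq, hX.eq]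
  congr 1 <;> noncomm_ring

/-- The difference of two symmetric solutions of the Riccati equation intertwines the two
closed-loop matrices up to transposition and sign. -/
lemma riccati_sub_mul_closedLoop {A S Q X Y : Matrix ι ι R} (hS : S.IsSymm) (hX : X.IsSymm)
    (hRX : X * A + Aᵀ * X + X * S * X - Q = 0) (hRY : Y * A + Aᵀ * Y + Y * S * Y - Q = 0) :
    (Y - X) * (A + S * Y) = -(A + S * X)ᵀ * (Y - X) := by
  rw [← sub_eq_zero]
  simp only [transpose_add, transpose_mul, hS.eq, hX.eq]
  calc _ = (Y * A + Aᵀ * Y + Y * S * Y - Q) - (X * A + Aᵀ * X + X * S * X - Q) := by noncomm_ring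
    _ = 0 := by rw [hRX, hRY, sub_zero]

lemma isRoot_charpoly_neg_transpose_iff {M : Matrix ι ι R} {μ : R} :
    (-Mᵀ).charpoly.IsRoot μ ↔ M.charpoly.IsRoot (-μ) := by
  have h : scalar ι μ - -Mᵀ = (-(scalar ι (-μ) - M))ᵀ := by
    rw [map_neg, transpose_neg, transpose_sub, transpose_neg, scalar_apply, diagonal_transpose]
    abel
  rw [Polynomial.IsRoot, Polynomial.IsRoot, Matrix.eval_charpoly, Matrix.eval_charpoly, h,
    det_transpose, det_neg]
  exact (IsUnit.pow _ isUnit_one.neg).mul_right_eq_zero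

end

theorem stmt_8 (n m : ℕ) (hn : 0 < n) (hm : 0 < m)
    (A : Matrix (Fin n) (Fin n) ℝ) (B : Matrix (Fin n) (Fin m) ℝ)
    (Q : Matrix (Fin n) (Fin n) ℝ) (U : Matrix (Fin m) (Fin m) ℝ)
    (hQ : Q.IsSymm) (hU : U.IsSymm) (hUunit : IsUnit U)
    (Em Ep : Matrix (Fin n) (Fin n) ℝ) (hEm : Em.IsSymm) (hEp : Ep.IsSymm)
    (hRm : Em * A + Aᵀ * Em + Em * (B * U⁻¹ * Bᵀ) * Em - Q = 0)
    (hRp : Ep * A + Aᵀ * Ep + Ep * (B * U⁻¹ * Bᵀ) * Ep - Q = 0)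
    (hdiff : IsUnit (Ep - Em))
    (hstab : ∀ μ : ℂ,
      ((A + B * U⁻¹ * Bᵀ * Em).map fun r => (r : ℂ)).charpoly.IsRoot μ → μ.re < 0) :
    (fromBlocks A (B * U⁻¹ * Bᵀ) Q (-Aᵀ)).charpoly
        = (A + B * U⁻¹ * Bᵀ * Em).charpoly * (A + B * U⁻¹ * Bᵀ * Ep).charpoly ∧
    ∀ μ : ℂ,
      ((fromBlocks A (B * U⁻¹ * Bᵀ) Q (-Aᵀ)).map fun r => (r : ℂ)).charpoly.IsRoot μ →
        μ.re ≠ 0 := by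
  have hS : (B * U⁻¹ * Bᵀ).IsSymm := by
    simp [Matrix.IsSymm, transpose_mul, transpose_nonsing_inv, hU.eq, Matrix.mul_assoc]
  have hM := charpoly_hamiltonian_of_riccati hS hEm hRm
  refine ⟨?_, fun μ hμ => ?_⟩
  · rw [hM, charpoly_eq_of_isUnit_of_mul_eq_mul hdiff (riccati_sub_mul_closedLoop hS hEm hRm hRp)]
  · change ((fromBlocks A (B * U⁻¹ * Bᵀ) Q (-Aᵀ)).map Complex.ofRealHom).charpoly.IsRoot μ at hμ
    rw [charpoly_map, hM, Polynomial.map_mul, ← charpoly_map, ← charpoly_map,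
      Polynomial.root_mul] at hμ
    rcases hμ with hμ | hμ
    · exact (hstab μ hμ).ne
    · rw [Matrix.map_neg _ (map_neg _), transpose_map, isRoot_charpoly_neg_transpose_iff] at hμ
      have := hstab (-μ) hμ
      rw [Complex.neg_re] at this
      linarith
end

section
/- Let n, m be positive integers, let A be a real n×n matrix, B a real n×m matrix, Q a symmetric positive definite real n×n matrix, U a symmetric positive definite real m×m matrix, and let x^d ∈ ℝⁿ, u^d ∈ ℝᵐ. Then for every T > 0 and all x₀, b ∈ ℝⁿ, there exists a unique pair of continuously differentiable functions x, λ : [0,T] → ℝⁿ satisfying x'(t) = A x(t) + B U⁻¹ Bᵀ λ(t) + B u^d and λ'(t) = Q x(t) − Aᵀ λ(t) − Q x^d for all t ∈ [0,T], together with the boundary conditions x(0) = x₀ and λ(T) = b. -/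
open Matrix Set

/-- The derivative of a dot product of vector-valued curves within a set. -/
theorem HasDerivWithinAt.dotProduct_real {n : ℕ} {x l : ℝ → Fin n → ℝ} {x' l' : Fin n → ℝ}
    {s : Set ℝ} {t : ℝ} (hx : HasDerivWithinAt x x' s t) (hl : HasDerivWithinAt l l' s t) :
    HasDerivWithinAt (fun r => x r ⬝ᵥ l r) (x' ⬝ᵥ l t + x t ⬝ᵥ l') s t := by
  have h := HasDerivWithinAt.fun_sum (u := Finset.univ) fun i _ =>
    (hasDerivWithinAt_pi.1 hx i).mul (hasDerivWithinAt_pi.1 hl i)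
  refine HasDerivWithinAt.congr_deriv (h.congr (fun r _ => ?_) ?_) ?_ <;>
    simp [dotProduct, Finset.sum_add_distrib]

/-- A linear homogeneous ODE with zero terminal value has only the zero solution. -/
theorem eq_zero_of_hasDerivWithinAt_clm_of_right {E : Type*} [NormedAddCommGroup E]
    [NormedSpace ℝ E] (L : E →L[ℝ] E) {a T : ℝ} {l : ℝ → E}
    (hl : ∀ t ∈ Icc a T, HasDerivWithinAt l (L (l t)) (Icc a T) t) (hT : l T = 0) :
    ∀ t ∈ Icc a T, l t = 0 := by
  have h := ODE_solution_unique_of_mem_Icc_left (v := fun _ => L) (s := fun _ => univ)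
    (K := ‖L‖₊) (f := l) (g := fun _ => 0) (a := a) (b := T)
    (fun t _ => L.lipschitz.lipschitzOnWith)
    (fun t ht => (hl t ht).continuousWithinAt)
    (fun t ht => (hl t (Ioc_subset_Icc_self ht)).mono_of_mem_nhdsWithin
      (Icc_mem_nhdsLE_of_mem ht))
    (fun _ _ => mem_univ _) continuousOn_const
    (fun t _ => by simpa using hasDerivWithinAt_const t (Iic t) (0 : E))
    (fun _ _ => mem_univ _) hT
  exact h

/-- The homogeneous extremal system with zero boundary data has only the zero solution. -/
theorem extremal_eq_zero {n : ℕ} {A S Q : Matrix (Fin n) (Fin n) ℝ} (hQ : Q.PosDef)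
    (hS : S.PosSemidef) {T : ℝ} (hT : 0 < T) {x l : ℝ → Fin n → ℝ}
    (hx : ∀ t ∈ Icc (0 : ℝ) T,
      HasDerivWithinAt x (A.mulVec (x t) + S.mulVec (l t)) (Icc 0 T) t)
    (hl : ∀ t ∈ Icc (0 : ℝ) T,
      HasDerivWithinAt l (Q.mulVec (x t) - Aᵀ.mulVec (l t)) (Icc 0 T) t)
    (hx0 : x 0 = 0) (hlT : l T = 0) :
    ∀ t ∈ Icc (0 : ℝ) T, x t = 0 ∧ l t = 0 := by
  have hd : ∀ t ∈ Icc (0 : ℝ) T, HasDerivWithinAt (fun r => x r ⬝ᵥ l r)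
      (l t ⬝ᵥ S.mulVec (l t) + x t ⬝ᵥ Q.mulVec (x t)) (Icc 0 T) t := by
    intro t ht
    convert (hx t ht).dotProduct_real (hl t ht) using 1
    rw [add_dotProduct, dotProduct_sub, mulVec_transpose, dotProduct_comm (S.mulVec _),
      dotProduct_comm (A.mulVec _), dotProduct_comm (x t) (l t ᵥ* A), dotProduct_mulVec (l t) A]
    ring
  have hSn : ∀ v : Fin n → ℝ, 0 ≤ v ⬝ᵥ S.mulVec v := fun v => by
    simpa using hS.dotProduct_mulVec_nonneg v
  have hQn : ∀ v : Fin n → ℝ, 0 ≤ v ⬝ᵥ Q.mulVec v := fun v => by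
    simpa using hQ.posSemidef.dotProduct_mulVec_nonneg v
  have hmono : MonotoneOn (fun r => x r ⬝ᵥ l r) (Icc 0 T) := by
    refine monotoneOn_of_hasDerivWithinAt_nonneg (convex_Icc 0 T)
      (fun t ht => (hd t ht).continuousWithinAt)
      (fun t ht => (hd t (interior_subset ht)).mono interior_subset)
      fun t _ => add_nonneg (hSn _) (hQn _)
  have hzero : ∀ t ∈ Icc (0 : ℝ) T, x t ⬝ᵥ l t = 0 := by
    intro t ht
    have h0 := hmono (left_mem_Icc.2 hT.le) ht ht.1
    have h1 := hmono ht (right_mem_Icc.2 hT.le) ht.2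
    simp only [hx0, hlT, zero_dotProduct, dotProduct_zero] at h0 h1
    exact le_antisymm h1 h0
  have hxz : ∀ t ∈ Icc (0 : ℝ) T, x t = 0 := by
    intro t ht
    have hc := (hasDerivWithinAt_const t (Icc (0 : ℝ) T) (0 : ℝ)).congr hzero (hzero t ht)
    have he := (uniqueDiffOn_Icc hT t ht).eq_deriv _ (hd t ht) hc
    by_contra hne
    have hpos : 0 < x t ⬝ᵥ Q.mulVec (x t) := by simpa using hQ.dotProduct_mulVec_pos hne
    linarith [hSn (l t)]
  have hlz := eq_zero_of_hasDerivWithinAt_clm_of_right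
    (LinearMap.toContinuousLinearMap (-Aᵀ.mulVecLin)) (l := l) (a := 0) (T := T)
    (fun t ht => by simpa [hxz t ht, mulVec_transpose] using hl t ht) hlT
  exact fun t ht => ⟨hxz t ht, hlz t ht⟩

/-- The exponential flow of a bounded linear operator solves the associated linear ODE. -/
theorem hasDerivAt_exp_smul_apply {E : Type*} [NormedAddCommGroup E] [NormedSpace ℝ E]
    [CompleteSpace E] (M : E →L[ℝ] E) (v : E) (t : ℝ) :
    HasDerivAt (fun s : ℝ => NormedSpace.exp (s • M) v) (M (NormedSpace.exp (t • M) v)) t :=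
  (hasDerivAt_exp_smul_const' (𝕂 := ℝ) M t).clm_apply (hasDerivAt_const t v) |>.congr_deriv
    (by simp)

/-- The linear system obtained from an inhomogeneous extremal system by adjoining a constant
coordinate that scales the inhomogeneity. -/
noncomputable def extremalGenerator {n : ℕ} (A S Q : Matrix (Fin n) (Fin n) ℝ)
    (c d : Fin n → ℝ) :
    ((Fin n → ℝ) × (Fin n → ℝ) × ℝ) →L[ℝ] ((Fin n → ℝ) × (Fin n → ℝ) × ℝ) :=
  LinearMap.toContinuousLinearMap
    { toFun := fun z => (A.mulVec z.1 + S.mulVec z.2.1 + z.2.2 • c,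
        Q.mulVec z.1 - Aᵀ.mulVec z.2.1 - z.2.2 • d, 0)
      map_add' := fun y z => by
        simp only [Prod.fst_add, Prod.snd_add, mulVec_add, add_smul, Prod.mk_add_mk, add_zero]
        congr 1
        · abel
        · congr 1
          abel
      map_smul' := fun r z => by
        simp only [Prod.smul_fst, Prod.smul_snd, mulVec_smul, smul_assoc, RingHom.id_apply,
          Prod.smul_mk, smul_add, smul_sub, smul_zero] }

/-- The flow of `extremalGenerator` solves the extremal system with scaled inhomogeneity. -/
theorem hasDerivAt_extremal_flow {n : ℕ} (A S Q : Matrix (Fin n) (Fin n) ℝ) (c d : Fin n → ℝ)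
    (v : (Fin n → ℝ) × (Fin n → ℝ) × ℝ) (t : ℝ) :
    let z := fun s : ℝ => NormedSpace.exp (s • extremalGenerator A S Q c d) v
    HasDerivAt (fun s => (z s).1) (A.mulVec (z t).1 + S.mulVec (z t).2.1 + v.2.2 • c) t ∧
      HasDerivAt (fun s => (z s).2.1)
        (Q.mulVec (z t).1 - Aᵀ.mulVec (z t).2.1 - v.2.2 • d) t := by
  intro z
  have hz : ∀ s, HasDerivAt z (extremalGenerator A S Q c d (z s)) s :=
    hasDerivAt_exp_smul_apply _ v
  have hs : ∀ s, HasDerivAt (fun s => (z s).2.2) 0 s := fun s => (hz s).snd.snd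
  have hconst : (z t).2.2 = v.2.2 := by
    rw [is_const_of_deriv_eq_zero (fun s => (hs s).differentiableAt) (fun s => (hs s).deriv) t 0]
    simp [z]
  rw [← hconst]
  exact ⟨(hz t).fst, (hz t).snd.fst⟩

theorem stmt_15 (n m : ℕ) (hn : 0 < n) (hm : 0 < m)
    (A : Matrix (Fin n) (Fin n) ℝ) (B : Matrix (Fin n) (Fin m) ℝ)
    (Q : Matrix (Fin n) (Fin n) ℝ) (U : Matrix (Fin m) (Fin m) ℝ)
    (hQ : Q.PosDef) (hU : U.PosDef)
    (xd : Fin n → ℝ) (ud : Fin m → ℝ)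
    (T : ℝ) (hT : 0 < T) (x₀ b : Fin n → ℝ) :
    ∃ x l : ℝ → (Fin n → ℝ),
      (∀ t ∈ Icc (0 : ℝ) T, HasDerivWithinAt x
          (A.mulVec (x t) + (B * U⁻¹ * Bᵀ).mulVec (l t) + B.mulVec ud) (Icc 0 T) t) ∧
      (∀ t ∈ Icc (0 : ℝ) T, HasDerivWithinAt l
          (Q.mulVec (x t) - Aᵀ.mulVec (l t) - Q.mulVec xd) (Icc 0 T) t) ∧
      x 0 = x₀ ∧ l T = b ∧
      ∀ x' l' : ℝ → (Fin n → ℝ),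
        (∀ t ∈ Icc (0 : ℝ) T, HasDerivWithinAt x'
            (A.mulVec (x' t) + (B * U⁻¹ * Bᵀ).mulVec (l' t) + B.mulVec ud) (Icc 0 T) t) →
        (∀ t ∈ Icc (0 : ℝ) T, HasDerivWithinAt l'
            (Q.mulVec (x' t) - Aᵀ.mulVec (l' t) - Q.mulVec xd) (Icc 0 T) t) →
        x' 0 = x₀ → l' T = b →
        ∀ t ∈ Icc (0 : ℝ) T, x' t = x t ∧ l' t = l t := by
  set S := B * U⁻¹ * Bᵀ
  have hS : S.PosSemidef := by
    simpa using hU.inv.posSemidef.mul_mul_conjTranspose_same B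
  let G := extremalGenerator A S Q (B.mulVec ud) (Q.mulVec xd)
  let J : (Fin n → ℝ) →ₗ[ℝ] (Fin n → ℝ) :=
    LinearMap.fst ℝ (Fin n → ℝ) ℝ ∘ₗ LinearMap.snd ℝ (Fin n → ℝ) ((Fin n → ℝ) × ℝ) ∘ₗ
      (NormedSpace.exp (T • G)).toLinearMap ∘ₗ
      LinearMap.inr ℝ (Fin n → ℝ) ((Fin n → ℝ) × ℝ) ∘ₗ LinearMap.inl ℝ (Fin n → ℝ) ℝ
  have hJ : Function.Surjective J := by
    rw [← LinearMap.injective_iff_surjective, injective_iff_map_eq_zero]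
    intro w hw
    have hflow := hasDerivAt_extremal_flow A S Q (B.mulVec ud) (Q.mulVec xd) (0, w, 0)
    have h := extremal_eq_zero hQ hS hT
      (fun t _ => by simpa using (hflow t).1.hasDerivWithinAt)
      (fun t _ => by simpa using (hflow t).2.hasDerivWithinAt)
      (by simp) hw 0 (left_mem_Icc.2 hT.le)
    simpa using h.2
  obtain ⟨w, hw⟩ := hJ (b - (NormedSpace.exp (T • G) (x₀, 0, 1)).2.1)
  have hflowT : (NormedSpace.exp (T • G) (x₀, w, 1)).2.1 = b := by
    have hsplit : ((x₀, w, 1) : (Fin n → ℝ) × (Fin n → ℝ) × ℝ) = (x₀, 0, 1) + (0, w, 0) := by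
      simp
    rw [hsplit, map_add]
    exact (congrArg _ hw).trans (add_sub_cancel _ _)
  have hflow := hasDerivAt_extremal_flow A S Q (B.mulVec ud) (Q.mulVec xd) (x₀, w, 1)
  simp only [one_smul] at hflow
  refine ⟨_, _, fun t _ => (hflow t).1.hasDerivWithinAt,
    fun t _ => (hflow t).2.hasDerivWithinAt, by simp, hflowT, ?_⟩
  intro x' l' hx' hl' hx0 hlT t ht
  have h := extremal_eq_zero (A := A) hQ hS hT
    (fun t ht => ((hx' t ht).sub (hflow t).1.hasDerivWithinAt).congr_deriv (by
      simp only [Pi.sub_apply, mulVec_sub]; abel))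
    (fun t ht => ((hl' t ht).sub (hflow t).2.hasDerivWithinAt).congr_deriv (by
      simp only [Pi.sub_apply, mulVec_sub]; abel))
    (by simp [hx0]) (sub_eq_zero.2 (hlT.trans hflowT.symm)) t ht
  exact ⟨sub_eq_zero.1 h.1, sub_eq_zero.1 h.2⟩
end
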